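/- arXiv:2507.18601 — 2 statements merged into one kernel-verified Lean document; each statement's English description precedes it below -/
import Mathlib

section
/- Fix s ≥ 1, r ≥ 1 and vectors k⃗^1,…,k⃗^r of s nonnegative integers. For each increasing integer vector n⃗ = (n_1 ≤ ⋯ ≤ n_s) define, recursively over the lattice of set partitions of {1,…,r} ordered by refinement, f_{0̂}(n⃗) := ∏_{j=1}^r (n⃗)_{k⃗^j} and f_π(n⃗) := ∏_{B∈π} (n⃗)_{Σ_{j∈B} k⃗^j} − Σ_{θ<π} f_θ(n⃗), so that ∏_{B∈π}(n⃗)_{Σ_{j∈B}k⃗^j} = Σ_{θ≤π} f_θ(n⃗) for every set partition π (here Σ_{j∈B}k⃗^j denotes coordinatewise sum). Then for every set partition π of {1,…,r} there is a constant C (depending only on s, r, π and the k⃗^j) such that |f_π(n⃗)| ≤ C·n^{β} for all integers n ≥ 1 and all n⃗ with n_1 ≤ ⋯ ≤ n_s ≤ n, where β = Σ_{j=1}^r (k^j_1+⋯+k^j_s) + |π| − r. -/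
/-- The generalized falling factorial `(n⃗)_{k⃗} = ∏_i (n_i − (k_1 + ⋯ + k_{i−1}))_{k_i}`. -/
noncomputable def genFallFact {s : ℕ} (n : Fin s → ℤ) (k : Fin s → ℕ) : ℤ :=
  ∏ i, (descPochhammer ℤ (k i)).eval (n i - ∑ j ∈ Finset.Iio i, (k j : ℤ))

open Classical in
/-- the product over blocks -/
noncomputable def blockProd {s r : ℕ} (k : Fin r → Fin s → ℕ) (π : Setoid (Fin r))
    (n : Fin s → ℤ) : ℤ :=
  ∏ q : Quotient π, genFallFact n fun i => ∑ j with Quotient.mk π j = q, k j i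

theorem finite_setoid_fin (r : ℕ) : Finite (Setoid (Fin r)) :=
  Finite.of_injective (fun π : Setoid (Fin r) => (fun a b => π a b : Fin r → Fin r → Prop))
    (fun _ _ h => Setoid.ext fun a b => iff_of_eq (congrFun (congrFun h a) b))

noncomputable instance fintypeSetoidFin (r : ℕ) : Fintype (Setoid (Fin r)) :=
  @Fintype.ofFinite _ (finite_setoid_fin r)

/-- the partition joining `l` and `j` -/
def joinTwo {r : ℕ} (l j : Fin r) : Setoid (Fin r) :=
  Relation.EqvGen.setoid (fun a b => a = l ∧ b = j)

theorem joinTwo_le {r : ℕ} (l j : Fin r) (π : Setoid (Fin r)) : joinTwo l j ≤ π ↔ π l j := by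
  constructor
  · intro h
    exact h (Relation.EqvGen.rel _ _ ⟨rfl, rfl⟩)
  · intro h
    apply Setoid.eqvGen_le
    rintro a b ⟨rfl, rfl⟩
    exact h

open Classical in
theorem card_join {r : ℕ} (l j : Fin r) (θ : Setoid (Fin r)) :
    Nat.card (Quotient θ) ≤ Nat.card (Quotient (θ ⊔ joinTwo l j)) + 1 := by
  let φ : Fin r → Quotient θ := fun a => if θ a l then Quotient.mk θ j else Quotient.mk θ a
  have hle : θ ⊔ joinTwo l j ≤ Setoid.ker φ := by
    apply sup_le
    · intro a b hab
      have : θ a l ↔ θ b l := ⟨fun h => θ.trans (θ.symm hab) h, fun h => θ.trans hab h⟩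
      show φ a = φ b
      simp only [φ, this]
      split_ifs
      · rfl
      · exact Quotient.sound hab
    · rw [joinTwo_le]
      show φ l = φ j
      simp only [φ]
      rw [if_pos (θ.refl l)]
      split_ifs <;> rfl
  let g : Quotient θ → Option (Quotient (θ ⊔ joinTwo l j)) := fun q =>
    if q = Quotient.mk θ l then none else
      some (Quotient.map' (s₁ := θ) (s₂ := θ ⊔ joinTwo l j) id
        (fun a b h => (le_sup_left : θ ≤ θ ⊔ joinTwo l j) h) q)
  have hg : Function.Injective g := by
    intro q q'
    induction q using Quotient.inductionOn with | _ a
    induction q' using Quotient.inductionOn with | _ b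
    intro h
    simp only [g] at h
    split_ifs at h with h1 h2 h2
    · rw [h1, h2]
    · have h3 : (θ ⊔ joinTwo l j) a b := Quotient.exact (Option.some.inj h)
      have h4 : φ a = φ b := hle h3
      have ha : ¬ θ a l := fun h => h1 (Quotient.sound h)
      have hb : ¬ θ b l := fun h => h2 (Quotient.sound h)
      simpa only [φ, if_neg ha, if_neg hb] using h4
  have := Nat.card_le_card_of_injective g hg
  rwa [Finite.card_option] at this

theorem genFallFact_succ {s : ℕ} (n : Fin s → ℤ) (k : Fin s → ℕ) (i : Fin s)
    (h : ∀ i', i < i' → k i' = 0) :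
    genFallFact n (fun a => k a + if a = i then 1 else 0) =
      genFallFact n k * (n i - ∑ a ∈ Finset.Iic i, (k a : ℤ)) := by
  have : (n i - ∑ a ∈ Finset.Iic i, (k a : ℤ)) =
      ∏ a, if a = i then (n i - ∑ a ∈ Finset.Iic i, (k a : ℤ)) else 1 := by
    simp
  rw [this]
  unfold genFallFact
  rw [← Finset.prod_mul_distrib]
  refine Finset.prod_congr rfl fun a _ => ?_
  beta_reduce
  rcases lt_trichotomy a i with hlt | rfl | hgt
  · rw [if_neg hlt.ne, if_neg hlt.ne, mul_one, add_zero]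
    congr 2
    refine Finset.sum_congr rfl fun b hb => ?_
    rw [if_neg ((Finset.mem_Iio.1 hb).trans hlt).ne, add_zero]
  · have h1 : ∑ b ∈ Finset.Iio a, ((k b + if b = a then 1 else 0 : ℕ) : ℤ) =
        ∑ b ∈ Finset.Iio a, (k b : ℤ) :=
      Finset.sum_congr rfl fun b hb => by
        rw [if_neg (Finset.mem_Iio.1 hb).ne, add_zero]
    have h2 : ∑ b ∈ Finset.Iic a, (k b : ℤ) = (k a : ℤ) + ∑ b ∈ Finset.Iio a, (k b : ℤ) := by
      rw [← Finset.Iio_insert, Finset.sum_insert (by simp)]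
    rw [h1, h2, if_pos rfl, if_pos rfl, descPochhammer_succ_right]
    simp only [Polynomial.eval_mul, Polynomial.eval_sub, Polynomial.eval_X,
      Polynomial.eval_natCast]
    ring
  · rw [if_neg hgt.ne', if_neg hgt.ne', h a hgt]
    simp

open Classical in
theorem blockProd_succ {s r : ℕ} (k : Fin r → Fin s → ℕ) (j : Fin r) (i : Fin s)
    (h : ∀ l i', i < i' → k l i' = 0) (π : Setoid (Fin r)) (n : Fin s → ℤ) :
    blockProd (fun l a => k l a + if l = j ∧ a = i then 1 else 0) π n =
      blockProd k π n * (n i - ∑ l, if π l j then ∑ a ∈ Finset.Iic i, (k l a : ℤ) else 0) := by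
  have h0 : (n i - ∑ l, if π l j then ∑ a ∈ Finset.Iic i, (k l a : ℤ) else 0) =
      ∏ q : Quotient π, if q = Quotient.mk π j then
        (n i - ∑ a ∈ Finset.Iic i, ((∑ l with Quotient.mk π l = q, k l a : ℕ) : ℤ)) else 1 := by
    rw [Finset.prod_ite_eq' Finset.univ (Quotient.mk π j), if_pos (Finset.mem_univ _)]
    push_cast
    rw [Finset.sum_comm, Finset.sum_filter]
    congr 1
    refine Finset.sum_congr rfl fun l _ => ?_
    have : (Quotient.mk π l = Quotient.mk π j) ↔ π l j := Quotient.eq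
    simp only [this]
  rw [h0]
  unfold blockProd
  rw [← Finset.prod_mul_distrib]
  refine Finset.prod_congr rfl fun q _ => ?_
  by_cases hq : q = Quotient.mk π j
  · rw [if_pos hq, ← genFallFact_succ]
    · congr 1
      funext a
      rw [Finset.sum_add_distrib]
      congr 1
      subst hq
      by_cases ha : a = i
      · simp [ha, Finset.sum_filter, Finset.sum_ite_eq']
      · simp [ha]
    · intro i' hi'
      exact Finset.sum_eq_zero fun l _ => h l i' hi'
  · rw [if_neg hq, mul_one]
    congr 1
    funext a
    refine Finset.sum_congr rfl fun l hl => ?_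
    beta_reduce
    rw [if_neg, add_zero]
    rintro ⟨rfl, -⟩
    exact hq (Finset.mem_filter.1 hl).2.symm

open Classical in
theorem key_step {s r : ℕ} (F : Setoid (Fin r) → (Fin s → ℤ) → ℤ)
    (f : Setoid (Fin r) → (Fin s → ℤ) → ℤ)
    (hF : ∀ π n, F π n = ∑ θ with θ ≤ π, f θ n) (i : Fin s) (j : Fin r) (c : Fin r → ℤ)
    (π : Setoid (Fin r)) (n : Fin s → ℤ) :
    F π n * (n i - ∑ l, if π l j then c l else 0) =
      ∑ ρ with ρ ≤ π, (n i * f ρ n - ∑ l, c l * ∑ θ with θ ⊔ joinTwo l j = ρ, f θ n) := by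
  rw [Finset.sum_sub_distrib, ← Finset.mul_sum, ← hF, Finset.sum_comm, mul_sub, mul_comm,
    Finset.mul_sum]
  congr 1
  refine Finset.sum_congr rfl fun l _ => ?_
  rw [← Finset.mul_sum]
  have : ∑ ρ with ρ ≤ π, ∑ θ with θ ⊔ joinTwo l j = ρ, f θ n =
      ∑ θ with θ ⊔ joinTwo l j ≤ π, f θ n := by
    simp only [Finset.sum_filter]
    simp only [← Finset.sum_filter]
    rw [Finset.sum_filter]
    simp only [Finset.sum_filter, ← Finset.sum_ite_irrel]
    have h1 : ∀ ρ : Setoid (Fin r), (if ρ ≤ π then ∑ θ, (if θ ⊔ joinTwo l j = ρ then f θ n else 0)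
        else 0) = ∑ θ, if θ ⊔ joinTwo l j = ρ then (if ρ ≤ π then f θ n else 0) else 0 := by
      intro ρ
      split_ifs <;> simp
    simp only [h1]
    rw [Finset.sum_comm]
    simp
  rw [this]
  simp only [sup_le_iff, joinTwo_le]
  by_cases hl : π l j
  · simp only [hl, and_true, if_true]
    rw [hF, mul_comm]
  · simp [hl]

open Classical in
theorem exists_good (s r : ℕ) (M : ℕ) : ∀ k : Fin r → Fin s → ℕ, (∑ j, ∑ i, k j i) = M →
    ∃ f : Setoid (Fin r) → (Fin s → ℤ) → ℤ,
      (∀ π n, blockProd k π n = ∑ θ with θ ≤ π, f θ n) ∧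
      ∀ π, ∃ C : ℝ, 0 ≤ C ∧ ∀ (N : ℕ) (n : Fin s → ℕ), 1 ≤ N → (∀ i, n i ≤ N) →
        |((f π fun i => (n i : ℤ)) : ℝ)| ≤
          C * (N : ℝ) ^ ((M : ℤ) + (Nat.card (Quotient π) : ℤ) - (r : ℤ)) := by
  induction M with
  | zero =>
    intro k hk
    have hk0 : ∀ j i, k j i = 0 := by
      intro j i
      have := (Finset.sum_eq_zero_iff.1 hk) j (Finset.mem_univ _)
      exact (Finset.sum_eq_zero_iff.1 this) i (Finset.mem_univ _)
    refine ⟨fun π _ => if π = ⊥ then 1 else 0, ?_, ?_⟩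
    · intro π n
      rw [Finset.sum_ite_eq']
      simp [blockProd, genFallFact, hk0]
    · intro π
      refine ⟨1, zero_le_one, fun N n hN hn => ?_⟩
      by_cases hπ : π = ⊥
      · have : Nat.card (Quotient π) = r := by
          subst hπ
          have e : Quotient (⊥ : Setoid (Fin r)) ≃ Fin r :=
            (Equiv.ofBijective (Quotient.mk (⊥ : Setoid (Fin r)))
              ⟨fun a b h => Quotient.exact h, Quotient.mk_surjective⟩).symm
          rw [Nat.card_congr e, Nat.card_fin]
        simp [hπ] at this ⊢
        simp [this]
      · simp only [if_neg hπ]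
        simp
        positivity
  | succ M ih =>
    intro k hk
    have hne : (Finset.univ.filter fun i : Fin s => ∃ j, k j i ≠ 0).Nonempty := by
      by_contra hcon
      rw [Finset.not_nonempty_iff_eq_empty] at hcon
      have h0 : ∀ j i, k j i = 0 := by
        intro j i
        by_contra hji
        have : i ∈ (Finset.univ.filter fun i : Fin s => ∃ j, k j i ≠ 0) := by
          simp only [Finset.mem_filter, Finset.mem_univ, true_and]
          exact ⟨j, hji⟩
        rw [hcon] at this
        simp at this
      simp [h0] at hk
    obtain ⟨i, hi, hmax⟩ := Finset.exists_max_image _ id hne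
    obtain ⟨j, hj⟩ := (Finset.mem_filter.1 hi).2
    have hz : ∀ l i', i < i' → k l i' = 0 := by
      intro l i' hlt
      by_contra hne
      exact absurd (hmax i' (Finset.mem_filter.2 ⟨Finset.mem_univ _, l, hne⟩)) (not_le.2 hlt)
    let k' : Fin r → Fin s → ℕ := fun l a => k l a - if l = j ∧ a = i then 1 else 0
    have hkk : k = fun l a => k' l a + if l = j ∧ a = i then 1 else 0 := by
      funext l a
      simp only [k']
      split_ifs with h
      · obtain ⟨rfl, rfl⟩ := h
        omega
      · simp
    have hz' : ∀ l i', i < i' → k' l i' = 0 := by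
      intro l i' hlt
      simp only [k', hz l i' hlt, Nat.zero_sub]
    have hsum : (∑ l, ∑ a, k' l a) = M := by
      have h1 : (∑ l, ∑ a, k l a) = (∑ l, ∑ a, k' l a) + 1 := by
        conv_lhs => rw [hkk]
        simp only [Finset.sum_add_distrib]
        congr 1
        simp [ite_and]
      omega
    obtain ⟨f, hf, hb⟩ := ih k' hsum
    choose C hC0 hC using hb
    let c : Fin r → ℤ := fun l => ∑ a ∈ Finset.Iic i, (k' l a : ℤ)
    refine ⟨fun ρ n => n i * f ρ n - ∑ l, c l * ∑ θ with θ ⊔ joinTwo l j = ρ, f θ n, ?_, ?_⟩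
    · intro π n
      rw [hkk, blockProd_succ k' j i hz', ← key_step _ f hf]
    · intro π
      refine ⟨C π + ∑ l, |(c l : ℝ)| * ∑ θ with θ ⊔ joinTwo l j = π, C θ, ?_, ?_⟩
      · refine add_nonneg (hC0 _) (Finset.sum_nonneg fun l _ => mul_nonneg (abs_nonneg _)
          (Finset.sum_nonneg fun θ _ => hC0 θ))
      intro N n hN hn
      have hN1 : (1 : ℝ) ≤ N := by exact_mod_cast hN
      have hN0 : (0 : ℝ) < N := by linarith
      push_cast
      rw [add_mul, Finset.sum_mul]
      refine (abs_sub _ _).trans (add_le_add ?_ ?_)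
      · rw [abs_mul]
        have e : (N : ℝ) ^ ((M : ℤ) + 1 + (Nat.card (Quotient π) : ℤ) - (r : ℤ)) =
            N * (N : ℝ) ^ ((M : ℤ) + (Nat.card (Quotient π) : ℤ) - (r : ℤ)) := by
          rw [← zpow_one_add₀ hN0.ne']
          congr 1
          ring
        rw [e, mul_left_comm]
        refine mul_le_mul ?_ (hC π N n hN hn) (abs_nonneg _) hN0.le
        rw [Nat.abs_cast]
        exact_mod_cast hn i
      · refine (Finset.abs_sum_le_sum_abs _ _).trans (Finset.sum_le_sum fun l _ => ?_)
        rw [abs_mul, mul_assoc]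
        refine mul_le_mul_of_nonneg_left ?_ (abs_nonneg _)
        rw [Finset.sum_mul]
        refine (Finset.abs_sum_le_sum_abs _ _).trans (Finset.sum_le_sum fun θ hθ => ?_)
        refine (hC θ N n hN hn).trans (mul_le_mul_of_nonneg_left ?_ (hC0 θ))
        refine zpow_le_zpow_right₀ hN1 ?_
        have := card_join l j θ
        rw [(Finset.mem_filter.1 hθ).2] at this
        omega

open Classical in
theorem moebius_unique {r : ℕ} (f g : Setoid (Fin r) → ℤ)
    (h : ∀ π, ∑ θ with θ ≤ π, f θ = ∑ θ with θ ≤ π, g θ) (π : Setoid (Fin r)) : f π = g π := by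
  have := finite_setoid_fin r
  induction π using WellFoundedLT.induction with
  | ind π ih =>
    have h1 : ∀ u : Setoid (Fin r) → ℤ, ∑ θ with θ ≤ π, u θ = u π + ∑ θ with θ < π, u θ := by
      intro u
      have : (Finset.univ.filter fun θ => θ ≤ π) =
          insert π (Finset.univ.filter fun θ => θ < π) := by
        ext θ
        simp [le_iff_eq_or_lt]
      rw [this, Finset.sum_insert (by simp)]
    have h2 := h π
    rw [h1, h1, Finset.sum_congr rfl (fun θ hθ => ih θ (Finset.mem_filter.1 hθ).2)] at h2
    exact add_right_cancel h2

/-- Let `f` be the family, indexed by set partitions `π` of `{1,…,r}`, characterized by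
`∏_{B∈π} (n⃗)_{Σ_{j∈B} k⃗^j} = Σ_{θ≤π} f_θ(n⃗)` (this uniquely determines the recursively
defined family of the statement).  Then `|f_π(n⃗)| ≤ C · n^{Σ_j |k⃗^j| + |π| − r}` uniformly
over increasing vectors `n⃗` with entries at most `n`. -/
theorem stmt4 (s r : ℕ) (hs : 1 ≤ s) (hr : 1 ≤ r) (k : Fin r → Fin s → ℕ)
    (f : Setoid (Fin r) → (Fin s → ℤ) → ℤ)
    (hf : ∀ (π : Setoid (Fin r)) (n : Fin s → ℤ),
      (∏ᶠ q : Quotient π,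
        genFallFact n fun i => ∑ᶠ j ∈ {j : Fin r | Quotient.mk π j = q}, k j i) =
        ∑ᶠ θ : {θ : Setoid (Fin r) // θ ≤ π}, f θ.1 n) :
    ∀ π : Setoid (Fin r), ∃ C : ℝ, ∀ (N : ℕ) (n : Fin s → ℕ), 1 ≤ N → Monotone n →
      (∀ i, n i ≤ N) →
      |((f π fun i => (n i : ℤ)) : ℝ)| ≤
        C * (N : ℝ) ^ ((∑ j, ∑ i, (k j i : ℤ)) + (Nat.card (Quotient π) : ℤ) - (r : ℤ)) := by
  classical
  intro π
  obtain ⟨g, hg, hb⟩ := exists_good s r _ k rfl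
  have hfg : ∀ π n, f π n = g π n := by
    intro π n
    refine moebius_unique (fun θ => f θ n) (fun θ => g θ n) (fun π => ?_) π
    have h1 := hf π n
    rw [finsum_eq_sum_of_fintype, finprod_eq_prod_of_fintype] at h1
    rw [← hg]
    have h2 : ∑ θ with θ ≤ π, f θ n = ∑ θ : {θ : Setoid (Fin r) // θ ≤ π}, f θ.1 n :=
      Finset.sum_subtype _ (by simp) _
    rw [h2, ← h1]
    unfold blockProd
    refine Finset.prod_congr rfl fun q _ => ?_
    congr 1
    funext i
    rw [finsum_mem_eq_finite_toFinset_sum _ (Set.toFinite _)]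
    refine Finset.sum_congr ?_ fun _ _ => rfl
    ext l
    simp
  obtain ⟨C, -, hC⟩ := hb π
  refine ⟨C, fun N n hN _ hn => ?_⟩
  rw [hfg]
  have := hC N n hN hn
  push_cast at this
  exact this
end

section
/- Let k ≥ 2 and n ≥ 1. Let π be an admissible set partition of {1,…,k}: no block of π contains two cyclically adjacent elements (i.e., no block contains both j and j+1 for some 1 ≤ j < k, and no block contains both k and 1). Let i : {1,…,k} → {1,…,n} satisfy i_a = i_b if and only if a and b lie in the same block of π, and set τ := (i_1 i_2)(i_2 i_3)⋯(i_{k−1} i_k)(i_k i_1), a product of k genuine transpositions. Let λ be the cycle type of τ and l(λ) := |λ| − ℓ(λ) (equal to the Cayley distance of τ). Then: (0) there exists a partition μ of k with all parts ≥ 2 such that Rem_k(μ) = λ; (1) if π is noncrossing then 2|π| = l(λ) + k + 2; (2) if π is not noncrossing then 2|π| ≤ l(λ) + k. -/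
/-- `Rem`: delete all parts equal to `2` and decrease every remaining part by `1`. -/
def remMap (μ : Multiset ℕ) : Multiset ℕ := (μ.filter fun x => 3 ≤ x).map fun x => x - 1

/-- `τ(i) = (i₁ i₂)(i₂ i₃)⋯(i_{k−1} i_k)(i_k i₁)` for a tuple `i : Fin k → Fin n`
(indices taken cyclically). -/
def tauOf {k n : ℕ} [NeZero k] (i : Fin k → Fin n) : Equiv.Perm (Fin n) :=
  (List.ofFn fun j : Fin k => Equiv.swap (i j) (i (j + 1))).prod

section helpers
open Equiv Equiv.Perm

theorem aux_setoid_le {α : Type*} [Fintype α] [DecidableEq α] (P : Perm α) (s : Setoid α)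
    (h : ∀ x, s x (P x)) : ∀ x y, SameCycle P x y → s x y := by
  intro x y hxy
  obtain ⟨m, hm⟩ := hxy.exists_nat_pow_eq
  subst hm
  induction m with
  | zero => exact s.refl x
  | succ m ih =>
    rw [pow_succ', mul_apply]
    exact s.trans (ih ⟨m, by simp⟩) (h _)

noncomputable def numOrb {α : Type*} (P : Perm α) : ℕ := Nat.card (Quotient (SameCycle.setoid P))

noncomputable def lenP {α : Type*} [Fintype α] [DecidableEq α] (P : Perm α) : ℤ :=
  (P.cycleType.sum : ℤ) - (Multiset.card P.cycleType : ℤ)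

theorem numOrb_eq {α : Type*} [Fintype α] [DecidableEq α] (P : Perm α) :
    (numOrb P : ℤ) + lenP P = Fintype.card α := by
  classical
  let φ : α → α ⊕ Perm α := fun x => if P x = x then Sum.inl x else Sum.inr (P.cycleOf x)
  have hφ : ∀ x y, SameCycle P x y ↔ φ x = φ y := by
    intro x y
    by_cases hx : P x = x
    · by_cases hy : P y = y
      · simp only [φ, hx, hy, if_true, Sum.inl.injEq]
        constructor
        · intro h; exact (h.eq_of_left hx)
        · rintro rfl; exact SameCycle.refl _ _
      · simp only [φ, hx, hy, if_true, if_false, reduceCtorEq, iff_false]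
        intro h; exact hy (h.apply_eq_self_iff.1 hx)
    · by_cases hy : P y = y
      · simp only [φ, hx, hy, if_true, if_false, reduceCtorEq, iff_false]
        intro h; exact hx (h.apply_eq_self_iff.2 hy)
      · simp only [φ, hx, hy, if_false, Sum.inr.injEq]
        constructor
        · intro h; exact h.cycleOf_eq
        · intro h
          have : y ∈ (P.cycleOf x).support := by
            rw [h, mem_support_cycleOf_iff]
            exact ⟨SameCycle.refl _ _, by simpa using hy⟩
          exact (mem_support_cycleOf_iff.1 this).1
  have hset : SameCycle.setoid P = Setoid.ker φ := by
    ext x y; exact hφ x y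
  have h1 : numOrb P = (Finset.univ.image φ).card := by
    unfold numOrb
    rw [hset, Nat.card_congr (Setoid.quotientKerEquivRange φ), ← Set.ncard_coe_finset,
      Nat.card_coe_set_eq]
    simp
  have h2 : Finset.univ.image φ =
      (P.supportᶜ).image Sum.inl ∪ P.cycleFactorsFinset.image Sum.inr := by
    ext z
    simp only [Finset.mem_image, Finset.mem_univ, true_and, Finset.mem_union, Finset.mem_compl,
      mem_support, not_not]
    constructor
    · rintro ⟨x, rfl⟩
      by_cases hx : P x = x
      · left; exact ⟨x, hx, by simp [φ, hx]⟩
      · right; exact ⟨P.cycleOf x, cycleOf_mem_cycleFactorsFinset_iff.2 (by simpa using hx), by simp [φ, hx]⟩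
    · rintro (⟨x, hx, rfl⟩ | ⟨c, hc, rfl⟩)
      · exact ⟨x, by simp [φ, hx]⟩
      · obtain ⟨hc1, hc2⟩ := mem_cycleFactorsFinset_iff.1 hc
        obtain ⟨x, hx⟩ := hc1.nonempty_support
        refine ⟨x, ?_⟩
        have := cycle_is_cycleOf hx hc
        have hx' : P x ≠ x := by rw [← hc2 x hx]; simpa using hx
        simp [φ, hx', this]
  have h3 : Disjoint ((P.supportᶜ).image (Sum.inl : α → α ⊕ Perm α)) (P.cycleFactorsFinset.image Sum.inr) := by
    rw [Finset.disjoint_left]; simp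
  rw [h1, h2, Finset.card_union_of_disjoint h3, Finset.card_image_of_injective _ Sum.inl_injective,
    Finset.card_image_of_injective _ Sum.inr_injective, lenP, sum_cycleType, cycleType_def]
  have := Finset.card_compl_add_card P.support
  simp
  omega

noncomputable def mergeS {α : Type*} (r : Setoid α) (a b : α) : Setoid α := by
  classical
  exact Setoid.ker (fun x => if r x b then (Quotient.mk r a) else Quotient.mk r x)

theorem mergeS_card {α : Type*} [Fintype α] (r : Setoid α) (a b : α) :
    (r a b → Nat.card (Quotient (mergeS r a b)) = Nat.card (Quotient r)) ∧
    (¬ r a b → Nat.card (Quotient (mergeS r a b)) + 1 = Nat.card (Quotient r)) := by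
  classical
  unfold mergeS
  rw [Nat.card_congr (Setoid.quotientKerEquivRange _)]
  constructor
  · intro h
    have : Set.range (fun x => if r x b then (Quotient.mk r a) else Quotient.mk r x) = Set.univ := by
      ext q; simp only [Set.mem_range, Set.mem_univ, iff_true]
      induction q using Quotient.inductionOn with
      | h x =>
        refine ⟨x, ?_⟩
        split_ifs with hx
        · exact Quotient.sound (r.trans h (r.symm hx))
        · rfl
    rw [this]; exact Nat.card_congr (Equiv.Set.univ _)
  · intro h
    have : Set.range (fun x => if r x b then (Quotient.mk r a) else Quotient.mk r x) = {Quotient.mk r b}ᶜ := by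
      ext q; simp only [Set.mem_range, Set.mem_compl_iff, Set.mem_singleton_iff]
      constructor
      · rintro ⟨x, rfl⟩
        split_ifs with hx
        · intro h'; exact h (Quotient.exact h')
        · intro h'; exact hx (Quotient.exact h')
      · induction q using Quotient.inductionOn with
        | h x =>
          intro hx
          refine ⟨x, ?_⟩
          rw [if_neg]
          intro h'; exact hx (Quotient.sound h')
    rw [this, Nat.card_coe_set_eq, Set.ncard_compl, Set.ncard_singleton]
    have : 0 < Nat.card (Quotient r) := @Nat.card_pos _ ⟨Quotient.mk r a⟩ _
    omega

theorem mergeS_le {α : Type*} (r s : Setoid α) (a b : α) (h : r ≤ s) (hab : s a b) :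
    mergeS r a b ≤ s := by
  classical
  intro x y hxy
  change (if r x b then (Quotient.mk r a) else Quotient.mk r x) = (if r y b then (Quotient.mk r a) else Quotient.mk r y) at hxy
  split_ifs at hxy with h1 h2 h2
  · exact s.trans (h h1) (s.symm (h h2))
  · exact s.trans (h h1) (s.trans (s.symm hab) (h (Quotient.exact hxy)))
  · exact s.trans (h (Quotient.exact hxy)) (s.trans hab (s.symm (h h2)))
  · exact h (Quotient.exact hxy)

theorem le_mergeS {α : Type*} (r : Setoid α) (a b : α) : r ≤ mergeS r a b := by
  classical
  intro x y hxy
  change (if r x b then (Quotient.mk r a) else Quotient.mk r x) = (if r y b then (Quotient.mk r a) else Quotient.mk r y)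
  have : r x b ↔ r y b := ⟨fun h => r.trans (r.symm hxy) h, fun h => r.trans hxy h⟩
  simp only [this]
  split_ifs
  · rfl
  · exact Quotient.sound hxy

theorem mergeS_rel {α : Type*} (r : Setoid α) (a b : α) : mergeS r a b a b := by
  classical
  change (if r a b then (Quotient.mk r a) else Quotient.mk r a) = (if r b b then (Quotient.mk r a) else Quotient.mk r b)
  rw [if_pos (r.refl b)]; simp

theorem mergeS_swap_le {α : Type*} [Fintype α] [DecidableEq α] (P : Perm α) (a b : α) :
    mergeS (SameCycle.setoid P) a b ≤ mergeS (SameCycle.setoid (P * swap a b)) a b := by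
  set s := mergeS (SameCycle.setoid (P * swap a b)) a b with hs
  refine mergeS_le _ _ _ _ ?_ (mergeS_rel _ _ _)
  intro x y hxy
  refine aux_setoid_le P s ?_ x y hxy
  intro x
  have h1 : s x (swap a b x) := by
    rcases eq_or_ne x a with rfl | hxa
    · rw [swap_apply_left]; exact mergeS_rel _ _ _
    rcases eq_or_ne x b with rfl | hxb
    · rw [swap_apply_right]; exact s.symm (mergeS_rel _ _ _)
    · rw [swap_apply_of_ne_of_ne hxa hxb]
  have h2 : s (swap a b x) ((P * swap a b) (swap a b x)) := by
    apply le_mergeS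
    exact ⟨1, by simp⟩
  have h3 : (P * swap a b) (swap a b x) = P x := by simp
  rw [h3] at h2
  exact s.trans h1 h2

theorem lenP_swap {α : Type*} [Fintype α] [DecidableEq α] (P : Perm α) (a b : α) (hab : a ≠ b) :
    (SameCycle P a b → lenP (P * swap a b) = lenP P - 1) ∧
    (¬ SameCycle P a b → lenP (P * swap a b) = lenP P + 1) := by
  have hR : mergeS (SameCycle.setoid P) a b = mergeS (SameCycle.setoid (P * swap a b)) a b := by
    apply le_antisymm (mergeS_swap_le P a b)
    have := mergeS_swap_le (P * swap a b) a b
    rwa [mul_assoc, swap_mul_self, mul_one] at this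
  have A := mergeS_card (SameCycle.setoid P) a b
  have B := mergeS_card (SameCycle.setoid (P * swap a b)) a b
  rw [← hR] at B
  have e1 := numOrb_eq P
  have e2 := numOrb_eq (P * swap a b)
  unfold numOrb at e1 e2
  have hs : sign (P * swap a b) = - sign P := by
    rw [Perm.sign_mul, sign_swap hab]; simp
  rw [sign_of_cycleType, sign_of_cycleType] at hs
  have hpar : lenP (P * swap a b) ≠ lenP P := by
    intro h
    unfold lenP at h
    have hh : (P * swap a b).cycleType.sum + Multiset.card (P * swap a b).cycleType + 2 * Multiset.card P.cycleType =
      P.cycleType.sum + Multiset.card P.cycleType + 2 * Multiset.card (P * swap a b).cycleType := by omega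
    have h2 := congrArg (fun m => (-1 : ℤˣ) ^ m) hh
    simp only [pow_add _ _ (2 * _), pow_mul, Int.units_sq, one_pow, mul_one] at h2
    rw [hs] at h2
    exact units_ne_neg_self _ h2.symm
  have hrP : (SameCycle.setoid P) a b ↔ SameCycle P a b := Iff.rfl
  have hn : Nat.card (Quotient (SameCycle.setoid (P * swap a b))) ≠ Nat.card (Quotient (SameCycle.setoid P)) := by
    intro h; apply hpar; omega
  rw [hrP] at A
  by_cases h' : (SameCycle.setoid (P * swap a b)) a b
  · have := B.1 h'
    constructor
    · intro h; have := A.1 h; omega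
    · intro h; have := A.2 h; omega
  · have := B.2 h'
    constructor
    · intro h; have := A.1 h; omega
    · intro h; have := A.2 h; omega

def prodW {α : Type*} [DecidableEq α] : List α → Perm α
  | x :: y :: t => prodW (y :: t) * swap y x
  | _ => 1

def NCw {α : Type*} (w : List α) : Prop := ∀ a b, [a, b, a, b].Sublist w → a = b

theorem NCw.tail {α : Type*} {x : α} {w : List α} (h : NCw (x :: w)) : NCw w :=
  fun a b hab => h a b (hab.cons x)

theorem NCw_cons {α : Type*} {x : α} {w : List α} :
    NCw (x :: w) ↔ NCw w ∧ ∀ q, [q, x, q].Sublist w → q = x := by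
  constructor
  · intro h
    exact ⟨h.tail, fun q hq => (h x q (hq.cons_cons x)).symm⟩
  · rintro ⟨h1, h2⟩ a b hab
    rw [List.cons_sublist_cons'] at hab
    rcases hab with h | ⟨rfl, h⟩
    · exact h1 _ _ h
    · exact (h2 _ h).symm

theorem interleave {α : Type*} (x z : α) (hxz : x ≠ z) (w : List α)
    (h1 : [x, z].Sublist w) (h2 : [z, x].Sublist w) :
    [x, z, x].Sublist w ∨ [z, x, z].Sublist w := by
  induction w with
  | nil => simp at h1
  | cons y w ih =>
    rw [List.cons_sublist_cons'] at h1 h2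
    rcases h1 with h1 | ⟨rfl, h1⟩
    · rcases h2 with h2 | ⟨rfl, h2⟩
      · rcases ih h1 h2 with h | h
        · left; exact h.cons _
        · right; exact h.cons _
      · right; exact h1.cons_cons _
    · rcases h2 with h2 | ⟨rfl, h2⟩
      · left; exact h2.cons_cons _
      · exact absurd rfl hxz

theorem NCw_self {α : Type*} {x : α} {w : List α} (h : NCw (x :: w)) : NCw (x :: x :: w) := by
  rw [NCw_cons]
  refine ⟨h, fun q hq => ?_⟩
  rw [List.cons_sublist_cons'] at hq
  rcases hq with hq | ⟨h, _⟩
  · exact (NCw_cons.1 h).2 q hq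
  · exact h

/-- when `z`, `x` both extend `w`. -/
theorem NCw_two {α : Type*} {x z : α} {w : List α} (hxz : x ≠ z) (hx : NCw (x :: w))
    (hz : NCw (z :: w)) : NCw (z :: x :: w) ↔ ¬ [z, x].Sublist w := by
  constructor
  · intro h hs
    exact hxz (h z x ((hs.cons_cons x).cons_cons z)).symm
  · intro hs
    rw [NCw_cons]
    refine ⟨hx, fun q hq => ?_⟩
    rw [List.cons_sublist_cons'] at hq
    rcases hq with hq | ⟨rfl, hq⟩
    · exact (NCw_cons.1 hz).2 q hq
    · exact absurd hq hs

theorem not_both {α : Type*} {x z : α} {w : List α} (hxz : x ≠ z) (hx : NCw (x :: w))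
    (hz : NCw (z :: w)) (h1 : [x, z].Sublist w) : ¬ [z, x].Sublist w := by
  intro h2
  rcases interleave x z hxz w h1 h2 with h | h
  · exact hxz ((NCw_cons.1 hz).2 x h)
  · exact hxz ((NCw_cons.1 hx).2 z h).symm

theorem prodW_head {α : Type*} [DecidableEq α] (t : List α) : ∀ x, prodW (x :: t) x =
    (x :: t).getLast (by simp) := by
  induction t with
  | nil => intro x; simp [prodW]
  | cons y t ih => intro x; simp [prodW, ih]

theorem prodW_notMem {α : Type*} [DecidableEq α] (w : List α) : ∀ z, z ∉ w → prodW w z = z := by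
  induction w with
  | nil => intro z _; simp [prodW]
  | cons x w ih =>
    intro z hz
    cases w with
    | nil => simp [prodW]
    | cons y t =>
      simp only [List.mem_cons, not_or] at hz ih
      simp only [prodW, mul_apply]
      rw [swap_apply_of_ne_of_ne hz.2.1 hz.1]
      exact ih z ⟨hz.2.1, hz.2.2⟩

/-- the stack invariant -/
structure Stk {α : Type*} [DecidableEq α] (y : α) (t : List α) (S : List α) : Prop where
  nodup : (y :: S).Nodup
  sub : (y :: S).Sublist (y :: t)
  mem : ∀ z, z ∈ y :: S ↔ z ∈ y :: t ∧ NCw (z :: y :: t)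
  chain : List.IsChain (fun u v => prodW (y :: t) v = u) (y :: S)
  top : prodW (y :: t) y = (y :: S).getLast (by simp)

theorem Stk.sameCycle {α : Type*} [DecidableEq α] [Fintype α] {y : α} {t S : List α} (h : Stk y t S) (z : α) :
    SameCycle (prodW (y :: t)) y z ↔ z ∈ y :: S := by
  have hc := h.chain
  have ht := h.top
  generalize prodW (y :: t) = P at hc ht
  constructor
  · intro hz
    have key : ∀ v ∈ y :: S, P v ∈ y :: S := by
      intro v hv
      rw [List.mem_cons] at hv
      rcases hv with rfl | hv
      · rw [ht]; exact List.getLast_mem _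
      · clear ht hz h
        generalize y = y' at hc
        induction S generalizing y' with
        | nil => simp at hv
        | cons s S ih =>
          rw [List.isChain_cons_cons] at hc
          rw [List.mem_cons] at hv
          rcases hv with rfl | hv
          · rw [hc.1]; simp
          · exact List.mem_cons_of_mem _ (ih hv _ hc.2)
    obtain ⟨m, rfl⟩ := hz.exists_nat_pow_eq
    clear hz
    induction m with
    | zero => simp
    | succ m ih => rw [pow_succ', mul_apply]; exact key _ ih
  · clear h ht
    generalize y = y' at hc
    induction S generalizing y' with
    | nil => intro hz; simp at hz; subst hz; exact SameCycle.refl _ _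
    | cons s S ih =>
      intro hz
      rw [List.isChain_cons_cons] at hc
      rw [List.mem_cons] at hz
      rcases hz with rfl | hz
      · exact SameCycle.refl _ _
      · have := ih _ hc.2 hz
        rw [← hc.1]
        exact sameCycle_apply_left.2 this

theorem Stk.push {α : Type*} [DecidableEq α] {y x : α} {t S : List α} (h : Stk y t S)
    (hw : NCw (y :: t)) (hx : x ∉ y :: t) : NCw (x :: y :: t) ∧ Stk x (y :: t) (y :: S) := by
  have hnc : NCw (x :: y :: t) := by
    rw [NCw_cons]; refine ⟨hw, fun q hq => ?_⟩
    exact absurd (hq.subset (by simp)) hx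
  have hxS : x ∉ y :: S := fun h' => hx (h.sub.subset h')
  have hfix := prodW_notMem _ _ hx
  refine ⟨hnc, ?_, h.sub.cons_cons x, ?_, ?_, ?_⟩
  · exact List.nodup_cons.2 ⟨hxS, h.nodup⟩
  · intro z
    rw [List.mem_cons]
    rcases eq_or_ne z x with rfl | hzx
    · simp [NCw_self hnc]
    · rw [List.mem_cons (b := x), h.mem]
      simp only [hzx, false_or]
      refine and_congr_right fun hz => ⟨fun h1 => ?_, fun h1 q r hqr => ?_⟩
      · rw [NCw_two hzx.symm hnc h1]
        intro h'; exact hx (h'.subset (by simp))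
      · exact h1 q r (hqr.trans ((List.sublist_cons_self _ _).cons_cons z))
  · rw [List.isChain_cons_cons]
    constructor
    · simp [prodW, hfix]
    · have hc := h.chain
      have hn := h.nodup
      simp only [prodW]
      rw [List.nodup_cons] at hn
      generalize prodW (y :: t) = P at hc
      cases S with
      | nil => simp
      | cons s S =>
        rw [List.isChain_iff_getElem] at hc ⊢
        intro i hi
        rw [mul_apply, swap_apply_of_ne_of_ne]
        · exact hc i hi
        · intro h'; apply hn.1; rw [← h']; simp
        · intro h'; apply hxS; rw [← h']; exact List.getElem_mem _
  · simp [prodW, h.top]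

theorem Stk.pop {α : Type*} [DecidableEq α] {y x : α} {t S : List α} (h : Stk y t S)
    (hx : x ∈ S) : ∃ B, Stk x (y :: t) B := by
  obtain ⟨A, B, rfl⟩ := List.append_of_mem hx
  have hn := h.nodup
  have hnc : NCw (x :: y :: t) := ((h.mem x).1 (by simp)).2
  have hyx : y ≠ x := by rintro rfl; simp at hn
  have hsub : (x :: B).Sublist (y :: t) :=
    ((List.sublist_append_right A (x :: B)).cons y).trans h.sub
  refine ⟨B, ?_, ?_, ?_, ?_, ?_⟩
  · exact hn.sublist ((List.sublist_append_right A (x :: B)).cons y)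
  · exact ((List.sublist_cons_self x B).trans hsub).cons_cons x
  · intro z
    rcases eq_or_ne z x with rfl | hzx
    · simp [NCw_self hnc]
    · by_cases hz : z ∈ y :: (A ++ x :: B)
      · have hz' := (h.mem z).1 hz
        rw [NCw_two hzx.symm hnc hz'.2]
        rw [← List.cons_append, List.mem_append] at hz
        constructor
        · intro hzB
          refine ⟨List.mem_cons_of_mem _ hz'.1, ?_⟩
          apply not_both hzx.symm hnc hz'.2
          rw [List.mem_cons] at hzB
          have : [x, z].Sublist (x :: B) := by
            simpa using hzB.resolve_left hzx
          exact this.trans hsub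
        · rintro ⟨-, h2⟩
          rcases hz with hz | hz
          · exfalso; apply h2
            refine List.Sublist.trans ?_ h.sub
            rw [← List.cons_append]
            exact List.Sublist.append (l₁ := [z]) (r₁ := [x]) (List.singleton_sublist.2 hz) (by simp)
          · exact hz
      · have hzB : z ∉ x :: B := fun h' => hz (by
          rw [List.mem_cons, List.mem_append]; exact Or.inr (Or.inr h'))
        simp only [hzB, false_iff, not_and]
        intro h1 h2
        rw [List.mem_cons] at h1
        exact hz ((h.mem z).2 ⟨h1.resolve_left hzx, fun q r hqr => h2 q r (hqr.trans ((List.sublist_cons_self _ _).cons_cons z))⟩)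
  · have hc := h.chain
    rw [← List.cons_append] at hc
    have hc2 := (List.isChain_append.1 hc).2.1
    simp only [prodW]
    have hn2 : (x :: B).Nodup := hn.sublist ((List.sublist_append_right A (x :: B)).cons y)
    have hyB : y ∉ B := by
      intro h'; simp [h'] at hn
    rw [List.nodup_cons] at hn2
    rw [List.isChain_iff_getElem] at hc2 ⊢
    intro i hi
    rw [mul_apply, swap_apply_of_ne_of_ne]
    · exact hc2 i hi
    · intro h'; apply hyB; rw [← h']; simp
    · intro h'
      have hm : (x :: B)[i + 1] ∈ B := by simp
      rw [h'] at hm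
      exact hn2.1 hm
  · have := h.top
    simp [prodW, this]

theorem main_inv {α : Type*} [DecidableEq α] [Fintype α] (t : List α) : ∀ y, List.IsChain (· ≠ ·) (y :: t) →
    2 * ((y :: t).toFinset.card : ℤ) ≤ lenP (prodW (y :: t)) + t.length + 2 ∧
    (¬ NCw (y :: t) → 2 * ((y :: t).toFinset.card : ℤ) < lenP (prodW (y :: t)) + t.length + 2) ∧
    (NCw (y :: t) → 2 * ((y :: t).toFinset.card : ℤ) = lenP (prodW (y :: t)) + t.length + 2 ∧
      ∃ S, Stk y t S) := by
  induction t with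
  | nil =>
    intro y _
    have hNC : NCw [y] := by
      intro a b h; simpa using h.length_le
    have h0 : 2 * (([y] : List α).toFinset.card : ℤ) = lenP (prodW [y]) + ([] : List α).length + 2 := by
      simp [prodW, lenP]
    refine ⟨h0.le, fun h => absurd hNC h, fun _ => ⟨h0, [], ?_⟩⟩
    refine ⟨by simp, by simp, ?_, by simp, by simp [prodW]⟩
    intro z
    simp only [List.mem_singleton]
    constructor
    · rintro rfl; exact ⟨rfl, NCw_self hNC⟩
    · exact fun h => h.1
  | cons y t ih =>
    intro x hch
    rw [List.isChain_cons_cons] at hch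
    obtain ⟨hxy, hch⟩ := hch
    obtain ⟨i1, i2, i3⟩ := ih y hch
    have hsw := lenP_swap (prodW (y :: t)) y x hxy.symm
    have hP : prodW (x :: y :: t) = prodW (y :: t) * swap y x := rfl
    rw [hP]
    have hlen : ((y :: t).length : ℤ) = t.length + 1 := by simp
    rw [hlen]
    by_cases hx : x ∈ y :: t
    · have hcard : (x :: y :: t).toFinset.card = (y :: t).toFinset.card := by
        rw [List.toFinset_cons (a := x), Finset.insert_eq_of_mem (by simpa using hx)]
      rw [hcard]
      have hge : lenP (prodW (y :: t)) - 1 ≤ lenP (prodW (y :: t) * swap y x) := by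
        by_cases hc : SameCycle (prodW (y :: t)) y x
        · have := hsw.1 hc; omega
        · have := hsw.2 hc; omega
      by_cases hw : NCw (y :: t)
      · obtain ⟨e, S, hS⟩ := i3 hw
        by_cases hxw : NCw (x :: y :: t)
        · have hxS : x ∈ y :: S := (hS.mem x).2 ⟨hx, hxw⟩
          have := hsw.1 ((hS.sameCycle x).2 hxS)
          have hxS' : x ∈ S := (List.mem_cons.1 hxS).resolve_left hxy
          refine ⟨by omega, fun h => absurd hxw h, fun _ => ⟨by omega, hS.pop hxS'⟩⟩
        · have hxS : x ∉ y :: S := fun h => hxw ((hS.mem x).1 h).2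
          have := hsw.2 (fun h => hxS ((hS.sameCycle x).1 h))
          exact ⟨by omega, fun _ => by omega, fun h => absurd h hxw⟩
      · have := i2 hw
        exact ⟨by omega, fun _ => by omega, fun h => absurd h.tail hw⟩
    · have hcard : (x :: y :: t).toFinset.card = (y :: t).toFinset.card + 1 := by
        rw [List.toFinset_cons (a := x), Finset.card_insert_of_notMem (by simpa using hx)]
      have hns : ¬ SameCycle (prodW (y :: t)) y x := by
        intro h
        have := h.symm.eq_of_left (prodW_notMem _ _ hx)
        exact hxy this
      have hl := hsw.2 hns
      rw [hcard]
      push_cast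
      refine ⟨by omega, fun h => ?_, fun h => ?_⟩
      · by_cases hw : NCw (y :: t)
        · obtain ⟨e, S, hS⟩ := i3 hw
          exact absurd (hS.push hw hx).1 h
        · have := i2 hw; omega
      · obtain ⟨e, S, hS⟩ := i3 h.tail
        exact ⟨by omega, _, (hS.push h.tail hx).2⟩
def wordR {α : Type*} (f : ℕ → α) (m : ℕ) : List α := ((List.range m).map f).reverse

theorem wordR_succ {α : Type*} (f : ℕ → α) (m : ℕ) : wordR f (m + 1) = f m :: wordR f m := by
  simp [wordR, List.range_succ]

theorem wordR_length {α : Type*} (f : ℕ → α) (m : ℕ) : (wordR f m).length = m := by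
  simp [wordR]

theorem prodW_wordR {α : Type*} [DecidableEq α] (f : ℕ → α) (m : ℕ) :
    prodW (wordR f (m + 1)) = (List.ofFn fun j : Fin m => swap (f j) (f (j + 1))).prod := by
  induction m with
  | zero => simp [wordR, prodW]
  | succ m ih =>
    rw [wordR_succ, wordR_succ, prodW, ← wordR_succ, ih, List.ofFn_succ']
    simp

theorem chain_wordR {α : Type*} (f : ℕ → α) (hf : ∀ j, f j ≠ f (j + 1)) (m : ℕ) :
    List.IsChain (· ≠ ·) (wordR f m) := by
  induction m with
  | zero => simp [wordR]
  | succ m ih =>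
    rw [wordR_succ]
    cases m with
    | zero => simp [wordR]
    | succ m =>
      rw [wordR_succ] at ih ⊢
      rw [List.isChain_cons_cons]
      exact ⟨(hf m).symm, ih⟩

theorem NCw_wordR {α : Type*} (f : ℕ → α) (m : ℕ) :
    NCw (wordR f m) ↔ ∀ a b c d : ℕ, a < b → b < c → c < d → d < m → f a = f c → f b = f d → f a = f b := by
  constructor
  · intro h a b c d hab hbc hcd hdm h1 h2
    refine (h (f b) (f a) ?_).symm
    rw [wordR, List.sublist_reverse_iff, List.sublist_map_iff]
    refine ⟨[a, b, c, d], ?_, by simp [h1, h2]⟩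
    apply List.sublist_of_subperm_of_pairwise (r := (· < ·))
    · apply List.subperm_of_subset
      · simp; omega
      · intro z; simp; omega
    · simp; omega
    · exact List.pairwise_lt_range
  · intro h a b hab
    rw [wordR, List.sublist_reverse_iff, List.sublist_map_iff] at hab
    obtain ⟨l, hl, he⟩ := hab
    have hp := List.pairwise_lt_range.sublist hl
    have hm := hl.subset
    have hlen : l.length = 4 := by
      have := congrArg List.length he
      simpa using this.symm
    rcases l with _ | ⟨p, _ | ⟨q, _ | ⟨r, _ | ⟨s, _ | ⟨s', l⟩⟩⟩⟩⟩
    case cons.cons.cons.cons.nil =>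
      simp at he hp
      have := hm (a := s) (by simp)
      simp at this
      obtain ⟨e1, e2, e3, e4⟩ := he
      have := h p q r s (by omega) (by omega) (by omega) this (by rw [← e1, ← e3]) (by rw [← e2, ← e4])
      rw [e1, e2, this]
    all_goals simp at hlen

theorem NCw_close {α : Type*} (x : α) (w : List α) :
    NCw (x :: (w ++ [x])) ↔ NCw (w ++ [x]) := by
  rw [NCw_cons]
  refine ⟨fun h => h.1, fun h => ⟨h, fun q hq => ?_⟩⟩
  by_contra hne
  have h1 : [q, x, q].Sublist w := by
    have := hq.reverse
    rw [List.reverse_append] at this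
    change [q, x, q].Sublist (x :: w.reverse) at this
    rw [List.cons_sublist_cons'] at this
    rcases this with h | ⟨h, _⟩
    · simpa using h.reverse
    · exact absurd h hne
  exact hne (h q x (h1.append (List.Sublist.refl [x])))

end helpers

/-- Let `π = ker i` be the set partition of `{1,…,k}` determined by the coincidences of
the tuple `i`, assumed admissible (no block contains cyclically adjacent elements), and
let `λ` be the cycle type of `τ = τ(i)`. Then (0) `λ ∈ Rem_k(Ȳ_k)`;
(1) if `π` is noncrossing then `2|π| = l(λ) + k + 2`;
(2) if `π` is not noncrossing then `2|π| ≤ l(λ) + k`. -/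
theorem stmt11 (k n : ℕ) [NeZero k] (hk : 2 ≤ k) (hn : 1 ≤ n)
    (i : Fin k → Fin n) (hadm : ∀ j : Fin k, i j ≠ i (j + 1)) :
    (∃ μ : Multiset ℕ, μ.sum = k ∧ (∀ x ∈ μ, 2 ≤ x) ∧
        remMap μ = (tauOf i).cycleType) ∧
    ((∀ a b c d : Fin k, a < b → b < c → c < d → i a = i c → i b = i d → i a = i b) →
      2 * (Nat.card (Quotient (Setoid.ker i)) : ℤ) =
        (((tauOf i).cycleType.sum : ℤ) - (Multiset.card (tauOf i).cycleType : ℤ)) +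
          (k : ℤ) + 2) ∧
    ((¬ ∀ a b c d : Fin k, a < b → b < c → c < d → i a = i c → i b = i d → i a = i b) →
      2 * (Nat.card (Quotient (Setoid.ker i)) : ℤ) ≤
        (((tauOf i).cycleType.sum : ℤ) - (Multiset.card (tauOf i).cycleType : ℤ)) +
          (k : ℤ)) := by
  
  obtain ⟨f, hf⟩ : ∃ f : ℕ → Fin n, f = fun j => i (Fin.ofNat k j) := ⟨_, rfl⟩
  have hfv : ∀ a : Fin k, f a = i a := by
    intro a; rw [hf]; simp
  have hfs : ∀ a : Fin k, f (a + 1) = i (a + 1) := by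
    intro a; simp only [hf]; congr 1; ext; simp [Fin.val_add]
  have hfadm : ∀ j, f j ≠ f (j + 1) := by
    intro j
    have := hadm (Fin.ofNat k j)
    rw [hf]
    convert this using 2
    ext; simp [Fin.val_add]
  have hf0 : f k = f 0 := by simp only [hf]; congr 1; ext; simp
  have htau : tauOf i = prodW (wordR f (k + 1)) := by
    rw [prodW_wordR, tauOf]
    simp only [hfv, hfs]
  have hinv := main_inv (wordR f k) (f k) (by rw [← wordR_succ]; exact chain_wordR f hfadm _)
  rw [← wordR_succ, ← htau, wordR_length] at hinv
  obtain ⟨hle, hcr, hnc⟩ := hinv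
  have hset : (wordR f (k + 1)).toFinset = Finset.univ.image i := by
    ext z
    simp only [wordR, List.mem_toFinset, List.mem_reverse, List.mem_map, List.mem_range,
      Finset.mem_image, Finset.mem_univ, true_and]
    constructor
    · rintro ⟨a, _, rfl⟩; exact ⟨Fin.ofNat k a, by rw [hf]⟩
    · rintro ⟨a, rfl⟩; exact ⟨a, by omega, hfv a⟩
  have hcard : Nat.card (Quotient (Setoid.ker i)) = (wordR f (k + 1)).toFinset.card := by
    rw [hset, Nat.card_congr (Setoid.quotientKerEquivRange i), Nat.card_coe_set_eq,
      ← Set.ncard_coe_finset]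
    simp
  have hNC : NCw (wordR f (k + 1)) ↔
      ∀ a b c d : Fin k, a < b → b < c → c < d → i a = i c → i b = i d → i a = i b := by
    have h1 : NCw (wordR f (k + 1)) ↔ NCw (wordR f k) := by
      obtain ⟨m, rfl⟩ : ∃ m, k = m + 1 := ⟨k - 1, by omega⟩
      rw [wordR_succ, hf0]
      have : wordR f (m + 1) = ((List.range m).map (f ∘ Nat.succ)).reverse ++ [f 0] := by
        simp [wordR, List.range_succ_eq_map]
      rw [this]
      exact NCw_close _ _
    rw [h1, NCw_wordR]
    constructor
    · intro h a b c d hab hbc hcd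
      have := h a b c d hab hbc hcd d.2
      simpa only [hfv] using this
    · intro h a b c d hab hbc hcd hd
      have := h ⟨a, by omega⟩ ⟨b, by omega⟩ ⟨c, by omega⟩ ⟨d, hd⟩ hab hbc hcd
      simpa only [← hfv] using this
  have hsgn : Equiv.Perm.sign (tauOf i) = (-1) ^ k := by
    have : ∀ m, Equiv.Perm.sign (prodW (wordR f (m + 1))) = (-1) ^ m := by
      intro m
      induction m with
      | zero => simp [wordR, prodW]
      | succ m ih =>
        rw [wordR_succ, wordR_succ, prodW, ← wordR_succ, Equiv.Perm.sign_mul, ih,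
          Equiv.Perm.sign_swap (hfadm m), pow_succ]
    rw [htau, this]
  rw [Equiv.Perm.sign_of_cycleType] at hsgn
  have hpar : ((tauOf i).cycleType.sum + Multiset.card (tauOf i).cycleType) % 2 = k % 2 := by
    rcases Nat.even_or_odd ((tauOf i).cycleType.sum + Multiset.card (tauOf i).cycleType) with h | h <;>
    rcases Nat.even_or_odd k with h' | h'
    · rw [Nat.even_iff.1 h, Nat.even_iff.1 h']
    · rw [h.neg_one_pow, h'.neg_one_pow] at hsgn; exact absurd hsgn (by decide)
    · rw [h.neg_one_pow, h'.neg_one_pow] at hsgn; exact absurd hsgn (by decide)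
    · rw [Nat.odd_iff.1 h, Nat.odd_iff.1 h']
  have hfix : tauOf i (f 0) = f 0 := by
    have := prodW_head (wordR f k) (f k)
    rw [hf0] at this
    rw [htau, wordR_succ, hf0, this]
    obtain ⟨m, rfl⟩ : ∃ m, k = m + 1 := ⟨k - 1, by omega⟩
    simp [wordR, List.range_succ_eq_map]
  have hsupp : (tauOf i).cycleType.sum + 1 ≤ (wordR f (k + 1)).toFinset.card := by
    rw [Equiv.Perm.sum_cycleType]
    have h0 : f 0 ∉ (tauOf i).support := by simpa using hfix
    rw [← Finset.card_insert_of_notMem h0]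
    apply Finset.card_le_card
    intro z hz
    rw [Finset.mem_insert] at hz
    rcases hz with rfl | hz
    · rw [hset, ← hf0, hf]; simp
    · rw [List.mem_toFinset]
      by_contra hz'
      rw [Equiv.Perm.mem_support, htau] at hz
      exact hz (prodW_notMem _ _ hz')
  rw [hcard]
  unfold lenP at hle hcr hnc
  refine ⟨?_, ?_, ?_⟩
  · obtain ⟨m, hm⟩ : ∃ m, (tauOf i).cycleType.sum + Multiset.card (tauOf i).cycleType + 2 * m = k :=
      ⟨(k - ((tauOf i).cycleType.sum + Multiset.card (tauOf i).cycleType)) / 2, by omega⟩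
    have h2 : ∀ x ∈ (tauOf i).cycleType, 2 ≤ x := fun x hx => Equiv.Perm.two_le_of_mem_cycleType hx
    refine ⟨(tauOf i).cycleType.map (· + 1) + Multiset.replicate m 2, ?_, ?_, ?_⟩
    · rw [Multiset.sum_add, Multiset.sum_map_add]
      simp
      omega
    · intro x hx
      rw [Multiset.mem_add, Multiset.mem_map] at hx
      rcases hx with ⟨y, hy, rfl⟩ | hx
      · have := h2 y hy; omega
      · rw [Multiset.eq_of_mem_replicate hx]
    · unfold remMap
      rw [Multiset.filter_add, Multiset.filter_eq_self.2, Multiset.filter_eq_nil.2]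
      · simp
      · intro x hx; rw [Multiset.eq_of_mem_replicate hx]; omega
      · intro x hx
        rw [Multiset.mem_map] at hx
        obtain ⟨y, hy, rfl⟩ := hx
        have := h2 y hy; omega
  · intro h
    have := (hnc (hNC.2 h)).1
    omega
  · intro h
    have := hcr (fun h' => h (hNC.1 h'))
    omega
end
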